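/- arXiv:gr-qc/9902006 — 2 statements merged into one kernel-verified Lean document; each statement's English description precedes it below -/
import Mathlib

section
/- Let n ≥ 1, let H be a real symmetric positive definite n×n matrix, let A be a real n×n matrix with H·A = Aᵀ·H (A is self-adjoint with respect to the inner product defined by H), and let B be a real n×n matrix such that HB + BᵀH is negative definite. Then every eigenvalue λ of the complex n×n matrix B + iA satisfies Re λ < 0. -/
open Matrix

theorem Matrix.IsSymm.dotProduct_mulVec_comm {ι R : Type*} [Fintype ι] [CommSemiring R]
    {S : Matrix ι ι R} (hS : S.IsSymm) (x y : ι → R) :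
    x ⬝ᵥ (S *ᵥ y) = y ⬝ᵥ (S *ᵥ x) := by
  rw [dotProduct_mulVec, dotProduct_comm, ← mulVec_transpose, hS.eq]

theorem Matrix.re_map_ofReal_mulVec {m ι : Type*} [Fintype ι] (M : Matrix m ι ℝ)
    (v : ι → ℂ) (i : m) :
    ((M.map Complex.ofReal *ᵥ v) i).re = (M *ᵥ fun j => (v j).re) i := by
  simp [mulVec, dotProduct]

theorem Matrix.im_map_ofReal_mulVec {m ι : Type*} [Fintype ι] (M : Matrix m ι ℝ)
    (v : ι → ℂ) (i : m) :
    ((M.map Complex.ofReal *ᵥ v) i).im = (M *ᵥ fun j => (v j).im) i := by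
  simp [mulVec, dotProduct]

/-- Symbol of a symmetric hyperbolic system: if `H` is real symmetric positive definite,
`A` is `H`-selfadjoint (`H*A = Aᵀ*H`), and `H*B + Bᵀ*H` is negative definite, then every
eigenvalue of the complex matrix `B + iA` has strictly negative real part. -/
theorem eigenvalues_neg_re_of_symbol
    (n : ℕ) (hn : 1 ≤ n) (H A B : Matrix (Fin n) (Fin n) ℝ)
    (hH : H.PosDef) (hA : H * A = Aᵀ * H)
    (hneg : ∀ x : Fin n → ℝ, x ≠ 0 → x ⬝ᵥ ((H * B + Bᵀ * H) *ᵥ x) < 0) :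
    ∀ (μ : ℂ) (v : Fin n → ℂ), v ≠ 0 →
      (B.map Complex.ofReal + Complex.I • A.map Complex.ofReal) *ᵥ v = μ • v →
      μ.re < 0 := by
  intro μ v hv hμ
  set x : Fin n → ℝ := fun j => (v j).re
  set y : Fin n → ℝ := fun j => (v j).im
  have hre : B *ᵥ x - A *ᵥ y = μ.re • x - μ.im • y := by
    ext i
    have h := congrArg Complex.re (congrFun hμ i)
    simpa [add_mulVec, smul_mulVec, re_map_ofReal_mulVec, im_map_ofReal_mulVec,
      sub_eq_add_neg] using h
  have him : B *ᵥ y + A *ᵥ x = μ.re • y + μ.im • x := by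
    ext i
    have h := congrArg Complex.im (congrFun hμ i)
    simpa [add_mulVec, smul_mulVec, re_map_ofReal_mulVec, im_map_ofReal_mulVec] using h
  have hHs : H.IsSymm := by
    simpa [IsHermitian, IsSymm, conjTranspose_eq_transpose_of_trivial] using hH.isHermitian
  have hHA : (H * A).IsSymm := by
    rw [IsSymm, transpose_mul, hHs.eq, hA]
  have hB (z : Fin n → ℝ) :
      z ⬝ᵥ ((H * B + Bᵀ * H) *ᵥ z) = 2 * (z ⬝ᵥ (H *ᵥ (B *ᵥ z))) := by
    have : z ⬝ᵥ ((Bᵀ * H) *ᵥ z) = z ⬝ᵥ ((H * B) *ᵥ z) := by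
      rw [dotProduct_mulVec, dotProduct_comm, ← mulVec_transpose, transpose_mul,
        transpose_transpose, hHs.eq]
    rw [add_mulVec, dotProduct_add, this, mulVec_mulVec]
    ring
  have energy : x ⬝ᵥ (H *ᵥ (B *ᵥ x)) + y ⬝ᵥ (H *ᵥ (B *ᵥ y)) =
      μ.re * (x ⬝ᵥ (H *ᵥ x) + y ⬝ᵥ (H *ᵥ y)) := by
    have h1 := congrArg (fun w => x ⬝ᵥ (H *ᵥ w)) hre
    have h2 := congrArg (fun w => y ⬝ᵥ (H *ᵥ w)) him
    have h3 := hHA.dotProduct_mulVec_comm x y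
    have h4 := hHs.dotProduct_mulVec_comm x y
    simp only [mulVec_sub, mulVec_add, mulVec_smul, dotProduct_sub, dotProduct_add,
      dotProduct_smul, smul_eq_mul] at h1 h2
    simp only [← mulVec_mulVec] at h3
    linear_combination h1 + h2 + h3 - μ.im * h4
  have hxy : x ≠ 0 ∨ y ≠ 0 := by
    by_contra! h
    exact hv (funext fun j => Complex.ext (congrFun h.1 j) (congrFun h.2 j))
  have neg (z : Fin n → ℝ) (hz : z ≠ 0) : z ⬝ᵥ (H *ᵥ (B *ᵥ z)) < 0 := by
    linarith [hneg z hz, hB z]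
  have nonpos (z : Fin n → ℝ) : z ⬝ᵥ (H *ᵥ (B *ᵥ z)) ≤ 0 := by
    rcases eq_or_ne z 0 with rfl | hz
    · simp
    · exact (neg z hz).le
  have nonneg (z : Fin n → ℝ) : 0 ≤ z ⬝ᵥ (H *ᵥ z) := by
    simpa using hH.posSemidef.dotProduct_mulVec_nonneg z
  have hlt : x ⬝ᵥ (H *ᵥ (B *ᵥ x)) + y ⬝ᵥ (H *ᵥ (B *ᵥ y)) < 0 :=
    hxy.elim (fun h => add_neg_of_neg_of_nonpos (neg x h) (nonpos y))
      (fun h => add_neg_of_nonpos_of_neg (nonpos x) (neg y h))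
  rw [energy] at hlt
  exact neg_of_mul_neg_left hlt (add_nonneg (nonneg x) (nonneg y))
end

section
/- Let n ≥ 1, let H be a real symmetric positive definite n×n matrix, let δ > 0 and R > 0, and let B₀ be a real n×n matrix with xᵀ(HB₀ + B₀ᵀH)x ≤ -δ·xᵀHx for all x ∈ ℝⁿ. Let B₁ be a continuous map from ℝⁿ to real n×n matrices, and let K > 0 be such that xᵀ(H·B₁(x) + B₁(x)ᵀ·H)x ≤ K·xᵀHx for all x with xᵀHx ≤ R². Then for every ε with 0 ≤ ε < δ/K the following holds: if u : [0,T) → ℝⁿ is differentiable, solves u'(t) = B₀·u(t) + ε·B₁(u(t))·u(t), and satisfies u(0)ᵀHu(0) ≤ R², then u(t)ᵀHu(t) ≤ e^{-(δ-εK)t}·u(0)ᵀHu(0) for all t ∈ [0,T); in particular u(t)ᵀHu(t) ≤ R² for all t. -/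
open Matrix

/-- The derivative of a quadratic form along a curve in coordinate space. -/
lemma hasDerivAt_dotProduct_mulVec {ι : Type*} [Fintype ι] (H : Matrix ι ι ℝ)
    {u : ℝ → ι → ℝ} {v : ι → ℝ} {t : ℝ} (hu : HasDerivAt u v t) :
    HasDerivAt (fun s => u s ⬝ᵥ (H *ᵥ u s)) (v ⬝ᵥ (H *ᵥ u t) + u t ⬝ᵥ (H *ᵥ v)) t := by
  have hc := hasDerivAt_pi.1 hu
  simp only [dotProduct, mulVec, ← Finset.sum_add_distrib]
  exact HasDerivAt.fun_sum fun i _ =>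
    (hc i).mul (HasDerivAt.fun_sum fun j _ => (hc j).const_mul (H i j))

lemma dotProduct_mul_add_transpose_mul_mulVec {ι : Type*} [Fintype ι] (H B : Matrix ι ι ℝ)
    (x : ι → ℝ) :
    x ⬝ᵥ ((H * B + Bᵀ * H) *ᵥ x) = (B *ᵥ x) ⬝ᵥ (H *ᵥ x) + x ⬝ᵥ (H *ᵥ (B *ᵥ x)) := by
  rw [add_mulVec, dotProduct_add, ← mulVec_mulVec, ← mulVec_mulVec, dotProduct_mulVec x Bᵀ,
    vecMul_transpose, add_comm]

/-- If a function satisfies `E' ≤ -c E` as long as `E ≤ M`, with `c, M > 0`, and starts below `M`,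
then it stays below `M` and decays exponentially. -/
lemma le_exp_mul_and_le_of_deriv_le_of_le {E E' : ℝ → ℝ} {c M t : ℝ} (hc : 0 < c) (hM : 0 < M)
    (ht : 0 ≤ t) (hE : ∀ s ∈ Set.Icc 0 t, HasDerivAt E (E' s) s)
    (hE' : ∀ s ∈ Set.Icc 0 t, E s ≤ M → E' s ≤ -c * E s) (h0 : E 0 ≤ M) :
    E t ≤ Real.exp (-c * t) * E 0 ∧ E t ≤ M := by
  have hcont : ContinuousOn E (Set.Icc 0 t) := fun s hs =>
    (hE s hs).continuousAt.continuousWithinAt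
  have hle : ∀ s ∈ Set.Icc 0 t, E s ≤ M := by
    refine fun s hs => image_le_of_deriv_right_lt_deriv_boundary (B := fun _ => M)
      (B' := fun _ => 0) hcont
      (fun x hx => (hE x (Set.Ico_subset_Icc_self hx)).hasDerivWithinAt) h0
      (fun x => hasDerivAt_const x M) (fun x hx hxM => ?_) hs
    have hxE := hE' x (Set.Ico_subset_Icc_self hx) hxM.le
    rw [hxM] at hxE
    nlinarith [mul_pos hc hM]
  have hderiv : ∀ s ∈ Set.Icc 0 t, HasDerivAt (fun s => Real.exp (c * s) * E s)
      (Real.exp (c * s) * (c * E s + E' s)) s := fun s hs =>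
    ((((hasDerivAt_id s).const_mul c).exp).mul (hE s hs)).congr_deriv (by simp; ring)
  have hanti : AntitoneOn (fun s => Real.exp (c * s) * E s) (Set.Icc 0 t) :=
    antitoneOn_of_hasDerivWithinAt_nonpos (convex_Icc 0 t)
      (fun s hs => (hderiv s hs).continuousAt.continuousWithinAt)
      (fun s hs => (hderiv s (interior_subset hs)).hasDerivWithinAt)
      (fun s hs => mul_nonpos_of_nonneg_of_nonpos (Real.exp_pos _).le (by
        linarith [hE' s (interior_subset hs) (hle s (interior_subset hs))]))
  refine ⟨?_, hle t ⟨ht, le_rfl⟩⟩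
  have h := hanti ⟨le_rfl, ht⟩ ⟨ht, le_rfl⟩ ht
  simp only [mul_zero, Real.exp_zero, one_mul] at h
  calc E t = Real.exp (-c * t) * (Real.exp (c * t) * E t) := by
        rw [← mul_assoc, ← Real.exp_add]; simp
    _ ≤ Real.exp (-c * t) * E 0 := by gcongr

/-- Nonlinear energy decay: if the zeroth-order matrix `B₀` satisfies the decay condition
`xᵀ(HB₀ + B₀ᵀH)x ≤ -δ xᵀHx`, the nonlinear term `B₁(x)` satisfies
`xᵀ(H B₁(x) + B₁(x)ᵀ H)x ≤ K xᵀHx` on the region `xᵀHx ≤ R²`, and `0 ≤ ε < δ/K`, then any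
solution of `u' = B₀ u + ε B₁(u) u` on `[0,T)` with initial energy `≤ R²` has exponentially
decaying energy and stays in the region `uᵀHu ≤ R²`. -/
theorem energy_decay_nonlinear
    (n : ℕ) (hn : 1 ≤ n) (H B₀ : Matrix (Fin n) (Fin n) ℝ)
    (δ R : ℝ) (hδ : 0 < δ) (hR : 0 < R) (hH : H.PosDef)
    (hneg : ∀ x : Fin n → ℝ,
      x ⬝ᵥ ((H * B₀ + B₀ᵀ * H) *ᵥ x) ≤ -δ * (x ⬝ᵥ (H *ᵥ x)))
    (B₁ : (Fin n → ℝ) → Matrix (Fin n) (Fin n) ℝ) (hB₁cont : Continuous B₁)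
    (K : ℝ) (hK : 0 < K)
    (hbound : ∀ x : Fin n → ℝ, x ⬝ᵥ (H *ᵥ x) ≤ R ^ 2 →
      x ⬝ᵥ ((H * B₁ x + (B₁ x)ᵀ * H) *ᵥ x) ≤ K * (x ⬝ᵥ (H *ᵥ x)))
    (ε : ℝ) (hε0 : 0 ≤ ε) (hε : ε < δ / K)
    (T : ℝ) (u : ℝ → Fin n → ℝ)
    (hu : ∀ t : ℝ, 0 ≤ t → t < T →
      HasDerivAt u (B₀ *ᵥ u t + ε • (B₁ (u t) *ᵥ u t)) t)
    (h0 : u 0 ⬝ᵥ (H *ᵥ u 0) ≤ R ^ 2) :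
    ∀ t : ℝ, 0 ≤ t → t < T →
      u t ⬝ᵥ (H *ᵥ u t) ≤
        Real.exp (-(δ - ε * K) * t) * (u 0 ⬝ᵥ (H *ᵥ u 0)) ∧
      u t ⬝ᵥ (H *ᵥ u t) ≤ R ^ 2 := by
  intro t ht0 htT
  have hc : 0 < δ - ε * K := sub_pos.2 ((lt_div_iff₀ hK).1 hε)
  refine le_exp_mul_and_le_of_deriv_le_of_le (E := fun s => u s ⬝ᵥ (H *ᵥ u s)) hc (pow_pos hR 2)
    ht0 (fun s hs => hasDerivAt_dotProduct_mulVec H (hu s hs.1 (hs.2.trans_lt htT)))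
    (fun s _ hsR => ?_) h0
  have hlin := hneg (u s)
  have hpert := mul_le_mul_of_nonneg_left (hbound (u s) hsR) hε0
  rw [dotProduct_mul_add_transpose_mul_mulVec] at hlin hpert
  simp only [add_dotProduct, mulVec_add, dotProduct_add, smul_dotProduct, mulVec_smul,
    dotProduct_smul, smul_eq_mul]
  linarith
end
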